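/- For every smooth ℂ-valued function ψ on Ω, the commutator of the rescaled Teukolsky operator with e₃ satisfies 𝐓_s(e₃ψ) − e₃(𝐓_s ψ) = 4(r−M)·e₃(e₃ψ) − 4r·T(e₃ψ) + 2(s−1)·e₃ψ + (1−2s)·Tψ at every point of Ω. -/

import Mathlib

noncomputable section

/-- `ℂ`-valued functions of the Boyer–Lindquist coordinates `(t, r, θ, φ)`. -/
abbrev KF : Type := ℝ → ℝ → ℝ → ℝ → ℂ

/-- Partial derivative in `t` (the operator `T`). -/
def pt (ψ : KF) : KF := fun t r θ φ => deriv (fun t' => ψ t' r θ φ) t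
/-- Partial derivative in `r`. -/
def pr (ψ : KF) : KF := fun t r θ φ => deriv (fun r' => ψ t r' θ φ) r
/-- Partial derivative in `θ`. -/
def pth (ψ : KF) : KF := fun t r θ φ => deriv (fun θ' => ψ t r θ' φ) θ
/-- Partial derivative in `φ` (the operator `Φ`). -/
def pph (ψ : KF) : KF := fun t r θ φ => deriv (fun φ' => ψ t r θ φ') φ

/-- `Δ(r) = r² − 2Mr + a²`. -/
def Δk (M a r : ℝ) : ℝ := r^2 - 2*M*r + a^2

/-- The null vector field `e₃`. -/
def e3 (M a : ℝ) (ψ : KF) : KF := fun t r θ φ =>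
  (1/2 : ℂ) * (-(pr ψ t r θ φ)
    + (((r^2 + a^2)/Δk M a r : ℝ) : ℂ) * pt ψ t r θ φ
    + ((a/Δk M a r : ℝ) : ℂ) * pph ψ t r θ φ)

/-- The null vector field `e₄`. -/
def e4 (M a : ℝ) (ψ : KF) : KF := fun t r θ φ =>
  (1/2 : ℂ) * (((Δk M a r/(r^2 + a^2) : ℝ) : ℂ) * pr ψ t r θ φ
    + pt ψ t r θ φ
    + ((a/(r^2 + a^2) : ℝ) : ℂ) * pph ψ t r θ φ)

/-- The spin-weighted operator `𝒰`. -/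
def Uop (M a : ℝ) (s : ℤ) (ψ : KF) : KF := fun t r θ φ =>
  ((1/Real.sin θ : ℝ) : ℂ) * pph ψ t r θ φ
  + ((a * Real.sin θ : ℝ) : ℂ) * pt ψ t r θ φ
  + Complex.I * (s : ℂ) *
      (((Real.cos θ/Real.sin θ) * ((r^2 + a^2 * (Real.cos θ)^2)/(r^2 + a^2)) : ℝ) : ℂ) *
      ψ t r θ φ

/-- The Teukolsky operator `𝐓̂_s`. -/
def TeukHat (M a : ℝ) (s : ℤ) (ψ : KF) : KF := fun t r θ φ =>
  -((((r^2 + a^2)^2/Δk M a r - a^2 * (Real.sin θ)^2 : ℝ)) : ℂ) * pt (pt ψ) t r θ φ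
  - ((4*M*a*r/Δk M a r : ℝ) : ℂ) * pt (pph ψ) t r θ φ
  - ((a^2/Δk M a r - 1/(Real.sin θ)^2 : ℝ) : ℂ) * pph (pph ψ) t r θ φ
  + ((Δk M a r ^ (-s) : ℝ) : ℂ) *
      pr (fun t' r' θ' φ' => ((Δk M a r' ^ (s+1) : ℝ) : ℂ) * pr ψ t' r' θ' φ') t r θ φ
  + ((1/Real.sin θ : ℝ) : ℂ) *
      pth (fun t' r' θ' φ' => ((Real.sin θ' : ℝ) : ℂ) * pth ψ t' r' θ' φ') t r θ φ
  + 2 * (s : ℂ) * (((a*(r - M)/Δk M a r : ℝ) : ℂ)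
      + Complex.I * ((Real.cos θ/(Real.sin θ)^2 : ℝ) : ℂ)) * pph ψ t r θ φ
  + 2 * (s : ℂ) * (((M*(r^2 - a^2)/Δk M a r - r : ℝ) : ℂ)
      - Complex.I * ((a * Real.cos θ : ℝ) : ℂ)) * pt ψ t r θ φ
  - ((((s : ℝ)^2 * (Real.cos θ)^2/(Real.sin θ)^2 - (s : ℝ) : ℝ)) : ℂ) * ψ t r θ φ

/-- The rescaled Teukolsky operator `𝐓_s = Δ^s 𝐓̂_s (Δ^{−s} ·)`. -/
def Teuk (M a : ℝ) (s : ℤ) (ψ : KF) : KF := fun t r θ φ =>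
  ((Δk M a r ^ s : ℝ) : ℂ) *
    TeukHat M a s (fun t' r' θ' φ' => ((Δk M a r' ^ (-s) : ℝ) : ℂ) * ψ t' r' θ' φ') t r θ φ

/-- The open region `Ω = {r₋ < r < r₊, 0 < θ < π}` of the Kerr black hole interior,
in Boyer–Lindquist coordinates `(t, r, θ, φ)`. -/
def KerrΩ (M a : ℝ) : Set (ℝ × ℝ × ℝ × ℝ) :=
  {p | M - Real.sqrt (M^2 - a^2) < p.2.1 ∧ p.2.1 < M + Real.sqrt (M^2 - a^2)
       ∧ 0 < p.2.2.1 ∧ p.2.2.1 < Real.pi}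

/-- The second-order angular operator `ð_{s−1}ð'_s`. -/
def edthMinus (s : ℤ) (ψ : KF) : KF := fun t r θ φ =>
  ((1/Real.sin θ : ℝ) : ℂ) *
      pth (fun t' r' θ' φ' => ((Real.sin θ' : ℝ) : ℂ) * pth ψ t' r' θ' φ') t r θ φ
  + ((1/(Real.sin θ)^2 : ℝ) : ℂ) * pph (pph ψ) t r θ φ
  + 2 * Complex.I * (s : ℂ) * ((Real.cos θ/(Real.sin θ)^2 : ℝ) : ℂ) * pph ψ t r θ φ
  - ((((s : ℝ)^2 * (Real.cos θ/Real.sin θ)^2 - (s : ℝ)) : ℝ) : ℂ) * ψ t r θ φ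

/-- The second-order angular operator `ð'_{s+1}ð_s`. -/
def edthPlus (s : ℤ) (ψ : KF) : KF := fun t r θ φ =>
  ((1/Real.sin θ : ℝ) : ℂ) *
      pth (fun t' r' θ' φ' => ((Real.sin θ' : ℝ) : ℂ) * pth ψ t' r' θ' φ') t r θ φ
  + ((1/(Real.sin θ)^2 : ℝ) : ℂ) * pph (pph ψ) t r θ φ
  + 2 * Complex.I * (s : ℂ) * ((Real.cos θ/(Real.sin θ)^2 : ℝ) : ℂ) * pph ψ t r θ φ
  - ((((s : ℝ)^2 * (Real.cos θ/Real.sin θ)^2 + (s : ℝ)) : ℝ) : ℂ) * ψ t r θ φ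

/-- The spin-weighted Carter operator `𝒬_s`. -/
def Qop (a : ℝ) (s : ℤ) (ψ : KF) : KF := fun t r θ φ =>
  ((a^2 * (Real.sin θ)^2 : ℝ) : ℂ) * pt (pt ψ) t r θ φ
  - 2 * Complex.I * (a : ℂ) * (s : ℂ) * ((Real.cos θ : ℝ) : ℂ) * pt ψ t r θ φ
  + ((1/Real.sin θ : ℝ) : ℂ) *
      pth (fun t' r' θ' φ' => ((Real.sin θ' : ℝ) : ℂ) * pth ψ t' r' θ' φ') t r θ φ
  + ((1/(Real.sin θ)^2 : ℝ) : ℂ) * pph (pph ψ) t r θ φ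
  + 2 * Complex.I * (s : ℂ) * ((Real.cos θ/(Real.sin θ)^2 : ℝ) : ℂ) * pph ψ t r θ φ
  - ((((s : ℝ)^2 * (Real.cos θ/Real.sin θ)^2 + (s : ℝ)) : ℝ) : ℂ) * ψ t r θ φ

/-- `f` is smooth on `U` as a function of the four coordinates. -/
def SmoothKF (U : Set (ℝ × ℝ × ℝ × ℝ)) (f : KF) : Prop :=
  ContDiffOn ℝ (⊤ : ℕ∞) (fun p : ℝ × ℝ × ℝ × ℝ => f p.1 p.2.1 p.2.2.1 p.2.2.2) U

/-- `f` and `g` agree on `U`. -/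
def EqKF (U : Set (ℝ × ℝ × ℝ × ℝ)) (f g : KF) : Prop :=
  ∀ t r θ φ : ℝ, (t, r, θ, φ) ∈ U → f t r θ φ = g t r θ φ

section Calculus

variable {U : Set (ℝ × ℝ × ℝ × ℝ)} {f g h : KF} {D E P Q : KF → KF}

theorem EqKF.symm (H : EqKF U f g) : EqKF U g f :=
  fun t r θ φ hp => (H t r θ φ hp).symm

theorem EqKF.trans (H : EqKF U f g) (K : EqKF U g h) : EqKF U f h :=
  fun t r θ φ hp => (H t r θ φ hp).trans (K t r θ φ hp)

theorem SmoothKF.add (hf : SmoothKF U f) (hg : SmoothKF U g) : SmoothKF U (f + g) :=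
  ContDiffOn.add hf hg

theorem SmoothKF.mul (hf : SmoothKF U f) (hg : SmoothKF U g) : SmoothKF U (f * g) :=
  ContDiffOn.mul hf hg

theorem SmoothKF.congr (hf : SmoothKF U f) (H : EqKF U f g) : SmoothKF U g :=
  ContDiffOn.congr hf fun p hp => (H p.1 p.2.1 p.2.2.1 p.2.2.2 hp).symm

theorem SmoothKF.differentiableAt (hU : IsOpen U) (hf : SmoothKF U f)
    {p : ℝ × ℝ × ℝ × ℝ} (hp : p ∈ U) :
    DifferentiableAt ℝ (fun p : ℝ × ℝ × ℝ × ℝ => f p.1 p.2.1 p.2.2.1 p.2.2.2) p :=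
  (ContDiffOn.contDiffAt hf (hU.mem_nhds hp)).differentiableAt (by simp)

/-- On smooth functions, `D` is the directional derivative along the constant vector `v`. -/
def IsDirDeriv (U : Set (ℝ × ℝ × ℝ × ℝ)) (v : ℝ × ℝ × ℝ × ℝ) (D : KF → KF) : Prop :=
  ∀ f, SmoothKF U f → ∀ t r θ φ : ℝ, (t, r, θ, φ) ∈ U →
    D f t r θ φ = fderiv ℝ (fun p : ℝ × ℝ × ℝ × ℝ => f p.1 p.2.1 p.2.2.1 p.2.2.2) (t, r, θ, φ) v

theorem isDirDeriv_pt (hU : IsOpen U) : IsDirDeriv U (1, 0, 0, 0) pt := by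
  intro f hf t r θ φ hp
  have hs : HasDerivAt (fun x : ℝ => (x, r, θ, φ)) ((1, 0, 0, 0) : ℝ × ℝ × ℝ × ℝ) t :=
    (hasDerivAt_id t).prodMk (hasDerivAt_const t (r, θ, φ))
  exact ((hf.differentiableAt hU hp).hasFDerivAt.comp_hasDerivAt t hs).deriv

theorem isDirDeriv_pr (hU : IsOpen U) : IsDirDeriv U (0, 1, 0, 0) pr := by
  intro f hf t r θ φ hp
  have hs : HasDerivAt (fun x : ℝ => (t, x, θ, φ)) ((0, 1, 0, 0) : ℝ × ℝ × ℝ × ℝ) r :=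
    (hasDerivAt_const r t).prodMk ((hasDerivAt_id r).prodMk (hasDerivAt_const r (θ, φ)))
  exact ((hf.differentiableAt hU hp).hasFDerivAt.comp_hasDerivAt r hs).deriv

theorem isDirDeriv_pth (hU : IsOpen U) : IsDirDeriv U (0, 0, 1, 0) pth := by
  intro f hf t r θ φ hp
  have hs : HasDerivAt (fun x : ℝ => (t, r, x, φ)) ((0, 0, 1, 0) : ℝ × ℝ × ℝ × ℝ) θ :=
    (hasDerivAt_const θ t).prodMk ((hasDerivAt_const θ r).prodMk
      ((hasDerivAt_id θ).prodMk (hasDerivAt_const θ φ)))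
  exact ((hf.differentiableAt hU hp).hasFDerivAt.comp_hasDerivAt θ hs).deriv

theorem isDirDeriv_pph (hU : IsOpen U) : IsDirDeriv U (0, 0, 0, 1) pph := by
  intro f hf t r θ φ hp
  have hs : HasDerivAt (fun x : ℝ => (t, r, θ, x)) ((0, 0, 0, 1) : ℝ × ℝ × ℝ × ℝ) φ :=
    (hasDerivAt_const φ t).prodMk ((hasDerivAt_const φ r).prodMk
      ((hasDerivAt_const φ θ).prodMk (hasDerivAt_id φ)))
  exact ((hf.differentiableAt hU hp).hasFDerivAt.comp_hasDerivAt φ hs).deriv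

/-- `D` acts as a derivation on the functions that are smooth on `U`. -/
structure IsDeriv (U : Set (ℝ × ℝ × ℝ × ℝ)) (D : KF → KF) : Prop where
  smooth : ∀ {f}, SmoothKF U f → SmoothKF U (D f)
  congr : ∀ {f g}, SmoothKF U f → EqKF U f g → EqKF U (D f) (D g)
  add : ∀ {f g}, SmoothKF U f → SmoothKF U g → EqKF U (D (f + g)) (D f + D g)
  mul : ∀ {f g}, SmoothKF U f → SmoothKF U g → EqKF U (D (f * g)) (D f * g + f * D g)

theorem IsDirDeriv.isDeriv (hU : IsOpen U) {v : ℝ × ℝ × ℝ × ℝ} (hD : IsDirDeriv U v D) :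
    IsDeriv U D where
  smooth {f} hf := by
    have h1 : ContDiffOn ℝ (⊤ : ℕ∞) (fun p => fderiv ℝ
        (fun p : ℝ × ℝ × ℝ × ℝ => f p.1 p.2.1 p.2.2.1 p.2.2.2) p v) U :=
      (ContDiffOn.fderiv_of_isOpen hf hU (by simp)).clm_apply contDiffOn_const
    exact h1.congr fun p hp => hD f hf p.1 p.2.1 p.2.2.1 p.2.2.2 hp
  congr {f g} hf H t r θ φ hp := by
    rw [hD f hf t r θ φ hp, hD g (hf.congr H) t r θ φ hp]
    have h1 : (fun p : ℝ × ℝ × ℝ × ℝ => f p.1 p.2.1 p.2.2.1 p.2.2.2) =ᶠ[nhds (t, r, θ, φ)]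
        fun p => g p.1 p.2.1 p.2.2.1 p.2.2.2 :=
      Filter.eventuallyEq_of_mem (hU.mem_nhds hp) fun p hp => H p.1 p.2.1 p.2.2.1 p.2.2.2 hp
    rw [h1.fderiv_eq]
  add {f g} hf hg t r θ φ hp := by
    rw [hD _ (hf.add hg) t r θ φ hp]
    have h1 := (hf.differentiableAt hU hp).hasFDerivAt.add (hg.differentiableAt hU hp).hasFDerivAt
    refine (DFunLike.congr_fun h1.fderiv v).trans ?_
    simp [hD f hf t r θ φ hp, hD g hg t r θ φ hp]
  mul {f g} hf hg t r θ φ hp := by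
    rw [hD _ (hf.mul hg) t r θ φ hp]
    have h1 := (hf.differentiableAt hU hp).hasFDerivAt.mul (hg.differentiableAt hU hp).hasFDerivAt
    refine (DFunLike.congr_fun h1.fderiv v).trans ?_
    simp [hD f hf t r θ φ hp, hD g hg t r θ φ hp]
    ring

theorem IsDirDeriv.comm (hU : IsOpen U) {v w : ℝ × ℝ × ℝ × ℝ} (hD : IsDirDeriv U v D)
    (hE : IsDirDeriv U w E) (hf : SmoothKF U f) : EqKF U (D (E f)) (E (D f)) := by
  have key : ∀ {v w : ℝ × ℝ × ℝ × ℝ} {D E : KF → KF}, IsDirDeriv U v D → IsDirDeriv U w E →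
      ∀ t r θ φ : ℝ, (t, r, θ, φ) ∈ U → D (E f) t r θ φ =
        fderiv ℝ (fderiv ℝ (fun p : ℝ × ℝ × ℝ × ℝ => f p.1 p.2.1 p.2.2.1 p.2.2.2))
          (t, r, θ, φ) v w := by
    intro v w D E hD hE t r θ φ hp
    rw [hD _ ((hE.isDeriv hU).smooth hf) t r θ φ hp]
    have h1 : (fun p : ℝ × ℝ × ℝ × ℝ => E f p.1 p.2.1 p.2.2.1 p.2.2.2) =ᶠ[nhds (t, r, θ, φ)]
        fun p => fderiv ℝ (fun p : ℝ × ℝ × ℝ × ℝ => f p.1 p.2.1 p.2.2.1 p.2.2.2) p w :=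
      Filter.eventuallyEq_of_mem (hU.mem_nhds hp) fun p hp => hE f hf p.1 p.2.1 p.2.2.1 p.2.2.2 hp
    have h2 : DifferentiableAt ℝ (fderiv ℝ
        (fun p : ℝ × ℝ × ℝ × ℝ => f p.1 p.2.1 p.2.2.1 p.2.2.2)) (t, r, θ, φ) :=
      ((ContDiffOn.contDiffAt hf (hU.mem_nhds hp)).fderiv_right (m := 1)
        (WithTop.coe_le_coe.2 (le_top : (2 : ℕ∞) ≤ ⊤))).differentiableAt (by simp)
    rw [h1.fderiv_eq, (h2.hasFDerivAt.clm_apply (hasFDerivAt_const w _)).fderiv]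
    simp
  intro t r θ φ hp
  rw [key hD hE t r θ φ hp, key hE hD t r θ φ hp]
  have h3 : IsSymmSndFDerivAt ℝ
      (fun p : ℝ × ℝ × ℝ × ℝ => f p.1 p.2.1 p.2.2.1 p.2.2.2) (t, r, θ, φ) :=
    (ContDiffOn.contDiffAt hf (hU.mem_nhds hp)).isSymmSndFDerivAt
      (by simp only [minSmoothness_of_isRCLikeNormedField]; exact WithTop.coe_le_coe.2 (le_top : (2 : ℕ∞) ≤ ⊤))
  exact h3 v w

/-- `P` preserves smoothness and equality on `U`, and commutes with `D` on smooth functions. -/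
structure CommutesWith (U : Set (ℝ × ℝ × ℝ × ℝ)) (D P : KF → KF) : Prop where
  smooth : ∀ {f}, SmoothKF U f → SmoothKF U (P f)
  congr : ∀ {f g}, SmoothKF U f → EqKF U f g → EqKF U (P f) (P g)
  comm : ∀ {f}, SmoothKF U f → EqKF U (D (P f)) (P (D f))

theorem CommutesWith.comp (hD : IsDeriv U D) (hP : CommutesWith U D P)
    (hQ : CommutesWith U D Q) : CommutesWith U D (fun f => P (Q f)) where
  smooth hf := hP.smooth (hQ.smooth hf)
  congr hf H := hP.congr (hQ.smooth hf) (hQ.congr hf H)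
  comm hf := (hP.comm (hQ.smooth hf)).trans
    (hP.congr (hD.smooth (hQ.smooth hf)) (hQ.comm hf))

theorem CommutesWith.add (hD : IsDeriv U D) (hP : CommutesWith U D P)
    (hQ : CommutesWith U D Q) : CommutesWith U D (fun f => P f + Q f) where
  smooth hf := (hP.smooth hf).add (hQ.smooth hf)
  congr hf H t r θ φ hp := congrArg₂ (· + ·) (hP.congr hf H t r θ φ hp) (hQ.congr hf H t r θ φ hp)
  comm hf := (hD.add (hP.smooth hf) (hQ.smooth hf)).trans fun t r θ φ hp =>
    congrArg₂ (· + ·) (hP.comm hf t r θ φ hp) (hQ.comm hf t r θ φ hp)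

theorem CommutesWith.mul_left (hD : IsDeriv U D) {c : KF} (hc : SmoothKF U c)
    (hDc : EqKF U (D c) 0) : CommutesWith U D (fun f => c * f) where
  smooth hf := hc.mul hf
  congr hf H t r θ φ hp := congrArg (c t r θ φ * ·) (H t r θ φ hp)
  comm hf := (hD.mul hc hf).trans fun t r θ φ hp => by
    simp [hDc t r θ φ hp]

end Calculus

/-- A real function of `r` alone, as a function of the four coordinates. -/
def radial (c : ℝ → ℝ) : KF := fun _ r _ _ => (c r : ℂ)

/-- A function of `θ` alone, as a function of the four coordinates. -/
def angular (c : ℝ → ℂ) : KF := fun _ _ θ _ => c θ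

theorem pt_radial (c : ℝ → ℝ) : pt (radial c) = 0 := by
  funext t r θ φ; simp [pt, radial]

theorem pth_radial (c : ℝ → ℝ) : pth (radial c) = 0 := by
  funext t r θ φ; simp [pth, radial]

theorem pph_radial (c : ℝ → ℝ) : pph (radial c) = 0 := by
  funext t r θ φ; simp [pph, radial]

theorem pr_radial {c : ℝ → ℝ} {c' r : ℝ} (h : HasDerivAt c c' r) (t θ φ : ℝ) :
    pr (radial c) t r θ φ = c' :=
  h.ofReal_comp.deriv

theorem e3_radial (M a : ℝ) {c : ℝ → ℝ} {c' r : ℝ} (h : HasDerivAt c c' r) (t θ φ : ℝ) :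
    e3 M a (radial c) t r θ φ = -(1 / 2) * (c' : ℂ) := by
  simp [e3, pt_radial, pph_radial, pr_radial h]

theorem e3_angular (M a : ℝ) (c : ℝ → ℂ) : e3 M a (angular c) = 0 := by
  funext t r θ φ; simp [e3, pt, pr, pph, angular]

theorem isOpen_KerrΩ (M a : ℝ) : IsOpen (KerrΩ M a) := by
  simp only [KerrΩ, Set.ofPred_and]
  refine .inter ?_ (.inter ?_ (.inter ?_ ?_)) <;> exact isOpen_lt (by fun_prop) (by fun_prop)

theorem Δk_ne_zero_of_mem {M a t r θ φ : ℝ} (hp : (t, r, θ, φ) ∈ KerrΩ M a) : Δk M a r ≠ 0 := by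
  obtain ⟨h1, h2, -, -⟩ := hp
  simp only at h1 h2
  have h3 : 0 < √(M ^ 2 - a ^ 2) := by linarith
  have h4 := Real.sq_sqrt (Real.sqrt_pos.1 h3).le
  unfold Δk
  nlinarith

theorem sin_ne_zero_of_mem {M a t r θ φ : ℝ} (hp : (t, r, θ, φ) ∈ KerrΩ M a) :
    Real.sin θ ≠ 0 :=
  (Real.sin_pos_of_pos_of_lt_pi hp.2.2.1 hp.2.2.2).ne'

theorem smoothKF_radial {M a : ℝ} {c : ℝ → ℝ}
    (hc : ∀ r, Δk M a r ≠ 0 → ContDiffAt ℝ (⊤ : ℕ∞) c r) : SmoothKF (KerrΩ M a) (radial c) := by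
  rintro ⟨t, r, θ, φ⟩ hp
  have h1 : ContDiffAt ℝ (⊤ : ℕ∞) (fun p : ℝ × ℝ × ℝ × ℝ => c p.2.1) (t, r, θ, φ) :=
    (hc r (Δk_ne_zero_of_mem hp)).comp (t, r, θ, φ)
      (by fun_prop : ContDiffAt ℝ (⊤ : ℕ∞) (fun p : ℝ × ℝ × ℝ × ℝ => p.2.1) (t, r, θ, φ))
  exact (Complex.ofRealCLM.contDiff.contDiffAt.comp (t, r, θ, φ) h1).contDiffWithinAt

theorem smoothKF_angular {M a : ℝ} {c : ℝ → ℂ}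
    (hc : ∀ θ, Real.sin θ ≠ 0 → ContDiffAt ℝ (⊤ : ℕ∞) c θ) :
    SmoothKF (KerrΩ M a) (angular c) := by
  rintro ⟨t, r, θ, φ⟩ hp
  have h1 : ContDiffAt ℝ (⊤ : ℕ∞) (fun p : ℝ × ℝ × ℝ × ℝ => c p.2.2.1) (t, r, θ, φ) :=
    (hc θ (sin_ne_zero_of_mem hp)).comp (t, r, θ, φ)
      (by fun_prop : ContDiffAt ℝ (⊤ : ℕ∞) (fun p : ℝ × ℝ × ℝ × ℝ => p.2.2.1) (t, r, θ, φ))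
  exact h1.contDiffWithinAt

section Kerr

variable {M a : ℝ} {s : ℤ} {f : KF} {D : KF → KF}

theorem isDeriv_pt : IsDeriv (KerrΩ M a) pt :=
  (isDirDeriv_pt (isOpen_KerrΩ M a)).isDeriv (isOpen_KerrΩ M a)

theorem isDeriv_pr : IsDeriv (KerrΩ M a) pr :=
  (isDirDeriv_pr (isOpen_KerrΩ M a)).isDeriv (isOpen_KerrΩ M a)

theorem isDeriv_pth : IsDeriv (KerrΩ M a) pth :=
  (isDirDeriv_pth (isOpen_KerrΩ M a)).isDeriv (isOpen_KerrΩ M a)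

theorem isDeriv_pph : IsDeriv (KerrΩ M a) pph :=
  (isDirDeriv_pph (isOpen_KerrΩ M a)).isDeriv (isOpen_KerrΩ M a)

theorem e3_eq (M a : ℝ) (f : KF) : e3 M a f = radial (fun _ => -1 / 2) * pr f
    + radial (fun r => (r ^ 2 + a ^ 2) / (2 * Δk M a r)) * pt f
    + radial (fun r => a / (2 * Δk M a r)) * pph f := by
  funext t r θ φ
  simp [e3, radial]
  ring

theorem smoothKF_e3_coeff_r : SmoothKF (KerrΩ M a) (radial fun _ => -1 / 2) :=
  smoothKF_radial fun _ _ => contDiffAt_const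

theorem smoothKF_e3_coeff_t :
    SmoothKF (KerrΩ M a) (radial fun r => (r ^ 2 + a ^ 2) / (2 * Δk M a r)) :=
  smoothKF_radial fun r hr => by
    have : 2 * Δk M a r ≠ 0 := mul_ne_zero two_ne_zero hr
    unfold Δk at *; fun_prop (disch := exact this)

theorem smoothKF_e3_coeff_φ : SmoothKF (KerrΩ M a) (radial fun r => a / (2 * Δk M a r)) :=
  smoothKF_radial fun r hr => by
    have : 2 * Δk M a r ≠ 0 := mul_ne_zero two_ne_zero hr
    unfold Δk at *; fun_prop (disch := exact this)

theorem isDeriv_e3 : IsDeriv (KerrΩ M a) (e3 M a) where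
  smooth hf := by
    rw [e3_eq]
    exact ((smoothKF_e3_coeff_r.mul (isDeriv_pr.smooth hf)).add
      (smoothKF_e3_coeff_t.mul (isDeriv_pt.smooth hf))).add
      (smoothKF_e3_coeff_φ.mul (isDeriv_pph.smooth hf))
  congr hf H t r θ φ hp := by
    simp only [e3, isDeriv_pr.congr hf H t r θ φ hp, isDeriv_pt.congr hf H t r θ φ hp,
      isDeriv_pph.congr hf H t r θ φ hp]
  add hf hg t r θ φ hp := by
    simp only [e3, isDeriv_pr.add hf hg t r θ φ hp, isDeriv_pt.add hf hg t r θ φ hp,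
      isDeriv_pph.add hf hg t r θ φ hp, Pi.add_apply]
    ring
  mul hf hg t r θ φ hp := by
    simp only [e3, isDeriv_pr.mul hf hg t r θ φ hp, isDeriv_pt.mul hf hg t r θ φ hp,
      isDeriv_pph.mul hf hg t r θ φ hp, Pi.add_apply, Pi.mul_apply]
    ring

/-- The commutator of `e₃` with a constant directional derivative. -/
theorem IsDirDeriv.apply_e3 {v : ℝ × ℝ × ℝ × ℝ} (hD : IsDirDeriv (KerrΩ M a) v D)
    (hf : SmoothKF (KerrΩ M a) f) :
    EqKF (KerrΩ M a) (D (e3 M a f)) (e3 M a (D f) + (D (radial fun _ => -1 / 2) * pr f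
      + D (radial fun r => (r ^ 2 + a ^ 2) / (2 * Δk M a r)) * pt f
      + D (radial fun r => a / (2 * Δk M a r)) * pph f)) := by
  intro t r θ φ hp
  have hU := isOpen_KerrΩ M a
  have hd := hD.isDeriv hU
  have sr := isDeriv_pr.smooth hf
  have st := isDeriv_pt.smooth hf
  have sp := isDeriv_pph.smooth hf
  have mr := smoothKF_e3_coeff_r.mul sr
  have mt := smoothKF_e3_coeff_t.mul st
  have mp := smoothKF_e3_coeff_φ.mul sp
  rw [e3_eq M a f, e3_eq M a (D f), hd.add (mr.add mt) mp t r θ φ hp]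
  simp only [Pi.add_apply, Pi.mul_apply]
  rw [hd.add mr mt t r θ φ hp]
  simp only [Pi.add_apply]
  rw [hd.mul smoothKF_e3_coeff_r sr t r θ φ hp, hd.mul smoothKF_e3_coeff_t st t r θ φ hp,
    hd.mul smoothKF_e3_coeff_φ sp t r θ φ hp]
  simp only [Pi.add_apply, Pi.mul_apply]
  rw [hD.comm hU (isDirDeriv_pr hU) hf t r θ φ hp, hD.comm hU (isDirDeriv_pt hU) hf t r θ φ hp,
    hD.comm hU (isDirDeriv_pph hU) hf t r θ φ hp]
  ring

theorem commutesWith_e3_of_radial {v : ℝ × ℝ × ℝ × ℝ} (hD : IsDirDeriv (KerrΩ M a) v D)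
    (h0 : ∀ c, D (radial c) = 0) : CommutesWith (KerrΩ M a) (e3 M a) D where
  smooth hf := (hD.isDeriv (isOpen_KerrΩ M a)).smooth hf
  congr hf H := (hD.isDeriv (isOpen_KerrΩ M a)).congr hf H
  comm hf := EqKF.symm fun t r θ φ hp => by
    rw [hD.apply_e3 hf t r θ φ hp]
    simp [h0]

theorem commutesWith_e3_pt : CommutesWith (KerrΩ M a) (e3 M a) pt :=
  commutesWith_e3_of_radial (isDirDeriv_pt (isOpen_KerrΩ M a)) pt_radial

theorem commutesWith_e3_pth : CommutesWith (KerrΩ M a) (e3 M a) pth :=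
  commutesWith_e3_of_radial (isDirDeriv_pth (isOpen_KerrΩ M a)) pth_radial

theorem commutesWith_e3_pph : CommutesWith (KerrΩ M a) (e3 M a) pph :=
  commutesWith_e3_of_radial (isDirDeriv_pph (isOpen_KerrΩ M a)) pph_radial

theorem commutesWith_e3_angular_mul {c : ℝ → ℂ}
    (hc : ∀ θ, Real.sin θ ≠ 0 → ContDiffAt ℝ (⊤ : ℕ∞) c θ) {P : KF → KF}
    (hP : CommutesWith (KerrΩ M a) (e3 M a) P) :
    CommutesWith (KerrΩ M a) (e3 M a) (fun f => angular c * P f) :=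
  CommutesWith.comp isDeriv_e3 (CommutesWith.mul_left isDeriv_e3 (smoothKF_angular hc)
    fun t r θ φ _ => by rw [e3_angular]) hP

theorem contDiffAt_ofReal_comp {c : ℝ → ℝ} {x : ℝ} (hc : ContDiffAt ℝ (⊤ : ℕ∞) c x) :
    ContDiffAt ℝ (⊤ : ℕ∞) (fun y => (c y : ℂ)) x :=
  Complex.ofRealCLM.contDiff.contDiffAt.comp x hc

/-- The Carter operator commutes with `e₃`. -/
theorem commutesWith_e3_Qop : CommutesWith (KerrΩ M a) (e3 M a) (Qop a s) := by
  have hQ : Qop a s = fun f => angular (fun θ => ((a ^ 2 * Real.sin θ ^ 2 : ℝ) : ℂ)) * pt (pt f)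
      + angular (fun θ => -(2 * Complex.I * a * s) * ((Real.cos θ : ℝ) : ℂ)) * pt f
      + angular (fun θ => ((1 / Real.sin θ : ℝ) : ℂ)) *
        pth (angular (fun θ => ((Real.sin θ : ℝ) : ℂ)) * pth f)
      + angular (fun θ => ((1 / Real.sin θ ^ 2 : ℝ) : ℂ)) * pph (pph f)
      + angular (fun θ => 2 * Complex.I * s * ((Real.cos θ / Real.sin θ ^ 2 : ℝ) : ℂ)) * pph f
      + angular (fun θ =>
        ((-((s : ℝ) ^ 2 * (Real.cos θ / Real.sin θ) ^ 2 + (s : ℝ)) : ℝ) : ℂ)) * f := by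
    funext f t r θ φ
    have h : (angular (fun θ => ((Real.sin θ : ℝ) : ℂ)) * pth f)
      = fun t' r' θ' φ' => ((Real.sin θ' : ℝ) : ℂ) * pth f t' r' θ' φ' := rfl
    simp only [Qop, h, Pi.add_apply, Pi.mul_apply, angular]
    push_cast
    ring
  have hid : CommutesWith (KerrΩ M a) (e3 M a) (fun f => f) :=
    ⟨id, fun _ H => H, fun _ _ _ _ _ _ => rfl⟩
  have h := isDeriv_e3 (M := M) (a := a)
  rw [hQ]
  refine .add h (.add h (.add h (.add h (.add h
    (commutesWith_e3_angular_mul ?_ (.comp h commutesWith_e3_pt commutesWith_e3_pt))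
    (commutesWith_e3_angular_mul ?_ commutesWith_e3_pt))
    (commutesWith_e3_angular_mul ?_ (.comp h commutesWith_e3_pth
      (commutesWith_e3_angular_mul ?_ commutesWith_e3_pth))))
    (commutesWith_e3_angular_mul ?_ (.comp h commutesWith_e3_pph commutesWith_e3_pph)))
    (commutesWith_e3_angular_mul ?_ commutesWith_e3_pph))
    (commutesWith_e3_angular_mul ?_ hid)
  · exact fun θ _ => contDiffAt_ofReal_comp (by fun_prop)
  · exact fun θ _ => contDiffAt_const.mul (contDiffAt_ofReal_comp (by fun_prop))
  · exact fun θ hθ => contDiffAt_ofReal_comp (by fun_prop (disch := exact hθ))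
  · exact fun θ _ => contDiffAt_ofReal_comp (by fun_prop)
  · exact fun θ hθ => contDiffAt_ofReal_comp (by fun_prop (disch := exact pow_ne_zero 2 hθ))
  · exact fun θ hθ => contDiffAt_const.mul
      (contDiffAt_ofReal_comp (by fun_prop (disch := exact pow_ne_zero 2 hθ)))
  · exact fun θ hθ => contDiffAt_ofReal_comp (by fun_prop (disch := exact hθ))

theorem hasDerivAt_Δk (M a r : ℝ) : HasDerivAt (Δk M a) (2 * (r - M)) r := by
  have h := (((hasDerivAt_id r).pow 2).sub ((hasDerivAt_id r).const_mul (2 * M))).add_const (a ^ 2)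
  refine HasDerivAt.congr_deriv h ?_
  simp
  ring

theorem contDiff_Δk (M a : ℝ) : ContDiff ℝ (⊤ : ℕ∞) (Δk M a) := by
  unfold Δk; fun_prop

theorem smoothKF_radial_zpow (n : ℤ) :
    SmoothKF (KerrΩ M a) (radial fun r => Δk M a r ^ n) := by
  refine smoothKF_radial fun r hr => ?_
  have h := (contDiff_Δk M a).contDiffAt (x := r)
  rcases n with n | n
  · simpa using h.pow n
  · simp only [zpow_negSucc]
    exact (h.pow (n + 1)).inv (pow_ne_zero _ hr)

theorem IsDeriv.radial_mul (hD : IsDeriv (KerrΩ M a) D) (h0 : ∀ c, D (radial c) = 0) {c : ℝ → ℝ}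
    (hc : SmoothKF (KerrΩ M a) (radial c)) (hf : SmoothKF (KerrΩ M a) f) :
    EqKF (KerrΩ M a) (D (radial c * f)) (radial c * D f) :=
  (hD.mul hc hf).trans fun t r θ φ _ => by simp [h0]

theorem IsDeriv.comp_radial_mul {E : KF → KF} (hD : IsDeriv (KerrΩ M a) D)
    (hE : IsDeriv (KerrΩ M a) E) (hD0 : ∀ c, D (radial c) = 0) (hE0 : ∀ c, E (radial c) = 0)
    {c : ℝ → ℝ} (hc : SmoothKF (KerrΩ M a) (radial c)) (hf : SmoothKF (KerrΩ M a) f) :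
    EqKF (KerrΩ M a) (D (E (radial c * f))) (radial c * D (E f)) :=
  (hD.congr (hE.smooth (hc.mul hf)) (hE.radial_mul hE0 hc hf)).trans
    (hD.radial_mul hD0 hc (hE.smooth hf))

theorem pth_sin_pth_radial_mul {c : ℝ → ℝ} (hc : SmoothKF (KerrΩ M a) (radial c))
    (hf : SmoothKF (KerrΩ M a) f) :
    EqKF (KerrΩ M a)
      (pth (fun t r θ φ => ((Real.sin θ : ℝ) : ℂ) * pth (radial c * f) t r θ φ))
      (radial c * pth (fun t r θ φ => ((Real.sin θ : ℝ) : ℂ) * pth f t r θ φ)) := by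
  have hsin : SmoothKF (KerrΩ M a) (angular fun θ => ((Real.sin θ : ℝ) : ℂ)) :=
    smoothKF_angular fun θ _ => contDiffAt_ofReal_comp (by fun_prop)
  refine (isDeriv_pth.congr (hsin.mul (isDeriv_pth.smooth (hc.mul hf)))
    (g := radial c * (angular (fun θ => ((Real.sin θ : ℝ) : ℂ)) * pth f)) ?_).trans
    (isDeriv_pth.radial_mul pth_radial hc (hsin.mul (isDeriv_pth.smooth hf)))
  intro t r θ φ hp
  simp only [Pi.mul_apply, isDeriv_pth.radial_mul pth_radial hc hf t r θ φ hp]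
  ring

/-- The radial second-order part of the Teukolsky operator, after conjugation by `Δ ^ s`. -/
theorem pr_zpow_pr_zpow_mul (hf : SmoothKF (KerrΩ M a) f) :
    EqKF (KerrΩ M a)
      (pr (fun t r θ φ => ((Δk M a r ^ (s + 1) : ℝ) : ℂ) *
        pr (radial (fun r => Δk M a r ^ (-s)) * f) t r θ φ))
      (radial (Δk M a) * pr (pr f) + radial (fun r => 2 * (1 - s) * (r - M)) * pr f
        + radial (fun _ => -2 * s) * f) := by
  have hw := smoothKF_radial_zpow (M := M) (a := a) (-s)
  have hΔ : SmoothKF (KerrΩ M a) (radial (Δk M a)) :=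
    smoothKF_radial fun r _ => (contDiff_Δk M a).contDiffAt
  have hl : SmoothKF (KerrΩ M a) (radial fun r => -2 * s * (r - M)) :=
    smoothKF_radial fun r _ => by fun_prop
  have sr := isDeriv_pr.smooth hf
  have h1 : EqKF (KerrΩ M a) (radial (Δk M a) * pr f + radial (fun r => -2 * s * (r - M)) * f)
      (fun t r θ φ => ((Δk M a r ^ (s + 1) : ℝ) : ℂ) *
        pr (radial (fun r => Δk M a r ^ (-s)) * f) t r θ φ) := by
    intro t r θ φ hp
    have hΔ0 := Δk_ne_zero_of_mem hp
    have hd : HasDerivAt (fun r => Δk M a r ^ (-s)) (_ * _) r :=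
      (hasDerivAt_zpow (-s) _ (.inl hΔ0)).comp r (hasDerivAt_Δk M a r)
    have e1 : ((Δk M a r ^ (s + 1) : ℝ) : ℂ) * ((Δk M a r ^ (-s) : ℝ) : ℂ) = (Δk M a r : ℝ) := by
      rw [← Complex.ofReal_mul, ← zpow_add₀ hΔ0]; simp
    have e2 : ((Δk M a r ^ (s + 1) : ℝ) : ℂ) * ((Δk M a r ^ (-s - 1) : ℝ) : ℂ) = 1 := by
      rw [← Complex.ofReal_mul, ← zpow_add₀ hΔ0]; simp
    beta_reduce
    rw [isDeriv_pr.mul hw hf t r θ φ hp]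
    simp only [Pi.add_apply, Pi.mul_apply, pr_radial hd, radial] at e1 e2 ⊢
    simp only [Complex.ofReal_mul, Complex.ofReal_sub, Complex.ofReal_neg, Complex.ofReal_intCast,
      Complex.ofReal_ofNat, Int.cast_neg] at e1 e2 ⊢
    linear_combination -(pr f t r θ φ) * e1 + 2 * s * (r - M) * f t r θ φ * e2
  refine (isDeriv_pr.congr ((hΔ.mul sr).add (hl.mul hf)) h1).symm.trans fun t r θ φ hp => ?_
  have hd : HasDerivAt (fun r => -2 * s * (r - M)) (-2 * s * 1) r :=
    ((hasDerivAt_id r).sub_const M).const_mul _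
  rw [isDeriv_pr.add (hΔ.mul sr) (hl.mul hf) t r θ φ hp]
  simp only [Pi.add_apply]
  rw [isDeriv_pr.mul hΔ sr t r θ φ hp, isDeriv_pr.mul hl hf t r θ φ hp]
  simp only [Pi.add_apply, Pi.mul_apply, pr_radial hd, pr_radial (hasDerivAt_Δk M a r), radial]
  push_cast
  ring

/-- The part of the rescaled Teukolsky operator whose coefficients depend on `r`. -/
def radialTeuk (M a : ℝ) (s : ℤ) (f : KF) : KF :=
  radial (fun r => -(r ^ 2 + a ^ 2) ^ 2 / Δk M a r) * pt (pt f)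
  + radial (fun r => -4 * M * a * r / Δk M a r) * pt (pph f)
  + radial (fun r => -a ^ 2 / Δk M a r) * pph (pph f)
  + radial (Δk M a) * pr (pr f)
  + radial (fun r => 2 * (1 - s) * (r - M)) * pr f
  + radial (fun r => 2 * s * (a * (r - M)) / Δk M a r) * pph f
  + radial (fun r => 2 * s * (M * (r ^ 2 - a ^ 2)) / Δk M a r - 2 * s * r) * pt f

/-- The rescaled Teukolsky operator splits into a radial part and the Carter operator. -/
theorem Teuk_eq (hf : SmoothKF (KerrΩ M a) f) :
    EqKF (KerrΩ M a) (Teuk M a s f) (radialTeuk M a s f + Qop a s f) := by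
  intro t r θ φ hp
  have hΔ0 := Δk_ne_zero_of_mem hp
  have hw := smoothKF_radial_zpow (M := M) (a := a) (-s)
  have hxy : ((Δk M a r ^ s : ℝ) : ℂ) * ((Δk M a r ^ (-s) : ℝ) : ℂ) = 1 := by
    rw [← Complex.ofReal_mul, ← zpow_add₀ hΔ0]; simp
  have hlam : (fun t' r' θ' φ' => ((Δk M a r' ^ (-s) : ℝ) : ℂ) * f t' r' θ' φ')
      = radial (fun r => Δk M a r ^ (-s)) * f := rfl
  simp only [Teuk, TeukHat, hlam]
  rw [isDeriv_pt.comp_radial_mul isDeriv_pt pt_radial pt_radial hw hf t r θ φ hp,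
    isDeriv_pt.comp_radial_mul isDeriv_pph pt_radial pph_radial hw hf t r θ φ hp,
    isDeriv_pph.comp_radial_mul isDeriv_pph pph_radial pph_radial hw hf t r θ φ hp,
    isDeriv_pt.radial_mul pt_radial hw hf t r θ φ hp,
    isDeriv_pph.radial_mul pph_radial hw hf t r θ φ hp,
    pth_sin_pth_radial_mul hw hf t r θ φ hp, pr_zpow_pr_zpow_mul hf t r θ φ hp]
  simp only [radialTeuk, Qop, Pi.add_apply, Pi.mul_apply, radial]
  generalize ((Δk M a r ^ s : ℝ) : ℂ) = x at *
  generalize ((Δk M a r ^ (-s) : ℝ) : ℂ) = y at *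
  push_cast
  refine Eq.trans (b := (x * y) * _) ?_ ((congrArg (· * _) hxy).trans (one_mul _))
  ring

/-- The commutator of `e₃` with `∂_r`. -/
theorem pr_e3 (hf : SmoothKF (KerrΩ M a) f) :
    EqKF (KerrΩ M a) (pr (e3 M a f)) (e3 M a (pr f)
      + (radial (fun r => -M * (r ^ 2 - a ^ 2) / Δk M a r ^ 2) * pt f
        + radial (fun r => -a * (r - M) / Δk M a r ^ 2) * pph f)) := by
  intro t r θ φ hp
  have hΔ0 := Δk_ne_zero_of_mem hp
  have hα : HasDerivAt (fun r => (r ^ 2 + a ^ 2) / (2 * Δk M a r))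
      (-M * (r ^ 2 - a ^ 2) / Δk M a r ^ 2) r := by
    have h := (((hasDerivAt_id r).pow 2).add_const (a ^ 2)).div
      ((hasDerivAt_Δk M a r).const_mul 2) (mul_ne_zero two_ne_zero hΔ0)
    refine HasDerivAt.congr_deriv h ?_
    simp only [id, Pi.pow_apply]
    field_simp
    unfold Δk
    push_cast
    ring
  have hβ : HasDerivAt (fun r => a / (2 * Δk M a r)) (-a * (r - M) / Δk M a r ^ 2) r := by
    have h := (hasDerivAt_const r a).div
      ((hasDerivAt_Δk M a r).const_mul 2) (mul_ne_zero two_ne_zero hΔ0)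
    refine HasDerivAt.congr_deriv h ?_
    field_simp
    ring
  rw [(isDirDeriv_pr (isOpen_KerrΩ M a)).apply_e3 hf t r θ φ hp]
  simp only [Pi.add_apply, Pi.mul_apply, pr_radial hα, pr_radial hβ,
    pr_radial (hasDerivAt_const r (-1 / 2 : ℝ)), radial]
  push_cast
  ring

theorem hasDerivAt_div_Δk {c : ℝ → ℝ} {c' r : ℝ} (hc : HasDerivAt c c' r) (h : Δk M a r ≠ 0) :
    HasDerivAt (fun r => c r / Δk M a r)
      ((c' * Δk M a r - c r * (2 * (r - M))) / Δk M a r ^ 2) r :=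
  hc.div (hasDerivAt_Δk M a r) h

/-- The commutator of `e₃` with `∂_r²`. -/
theorem pr_pr_e3 (hf : SmoothKF (KerrΩ M a) f) :
    EqKF (KerrΩ M a) (pr (pr (e3 M a f))) (e3 M a (pr (pr f))
      + (radial (fun r => -2 * M * (r ^ 2 - a ^ 2) / Δk M a r ^ 2) * pt (pr f)
        + radial (fun r => -2 * a * (r - M) / Δk M a r ^ 2) * pph (pr f))
      + (radial (fun r => (-2 * M * r * Δk M a r + 4 * M * (r ^ 2 - a ^ 2) * (r - M))
            / Δk M a r ^ 3) * pt f
        + radial (fun r => (-a * Δk M a r + 4 * a * (r - M) ^ 2) / Δk M a r ^ 3) * pph f)) := by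
  intro t r θ φ hp
  have hU := isOpen_KerrΩ M a
  have hΔ0 := Δk_ne_zero_of_mem hp
  have sr := isDeriv_pr.smooth hf
  have st := isDeriv_pt.smooth hf
  have sp := isDeriv_pph.smooth hf
  have hα : SmoothKF (KerrΩ M a) (radial fun r => -M * (r ^ 2 - a ^ 2) / Δk M a r ^ 2) :=
    smoothKF_radial fun r hr => by
      have h := pow_ne_zero 2 hr
      unfold Δk at *; fun_prop (disch := exact h)
  have hβ : SmoothKF (KerrΩ M a) (radial fun r => -a * (r - M) / Δk M a r ^ 2) :=
    smoothKF_radial fun r hr => by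
      have h := pow_ne_zero 2 hr
      unfold Δk at *; fun_prop (disch := exact h)
  have dα : HasDerivAt (fun r => -M * (r ^ 2 - a ^ 2) / Δk M a r ^ 2)
      ((-2 * M * r * Δk M a r + 4 * M * (r ^ 2 - a ^ 2) * (r - M)) / Δk M a r ^ 3) r := by
    have h := ((((hasDerivAt_id r).pow 2).sub_const (a ^ 2)).const_mul (-M)).div
      ((hasDerivAt_Δk M a r).pow 2) (pow_ne_zero 2 hΔ0)
    refine HasDerivAt.congr_deriv h ?_
    simp only [id, Pi.pow_apply]
    field_simp
    push_cast
    ring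
  have dβ : HasDerivAt (fun r => -a * (r - M) / Δk M a r ^ 2)
      ((-a * Δk M a r + 4 * a * (r - M) ^ 2) / Δk M a r ^ 3) r := by
    have h := (((hasDerivAt_id r).sub_const M).const_mul (-a)).div
      ((hasDerivAt_Δk M a r).pow 2) (pow_ne_zero 2 hΔ0)
    refine HasDerivAt.congr_deriv h ?_
    simp only [id, Pi.pow_apply]
    field_simp
    push_cast
    ring
  rw [isDeriv_pr.congr (isDeriv_pr.smooth (isDeriv_e3.smooth hf)) (pr_e3 hf) t r θ φ hp,
    isDeriv_pr.add (isDeriv_e3.smooth sr) ((hα.mul st).add (hβ.mul sp)) t r θ φ hp]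
  simp only [Pi.add_apply]
  rw [pr_e3 sr t r θ φ hp, isDeriv_pr.add (hα.mul st) (hβ.mul sp) t r θ φ hp]
  simp only [Pi.add_apply]
  rw [isDeriv_pr.mul hα st t r θ φ hp, isDeriv_pr.mul hβ sp t r θ φ hp]
  simp only [Pi.add_apply, Pi.mul_apply, pr_radial dα, pr_radial dβ]
  rw [(isDirDeriv_pr hU).comm hU (isDirDeriv_pt hU) hf t r θ φ hp,
    (isDirDeriv_pr hU).comm hU (isDirDeriv_pph hU) hf t r θ φ hp]
  simp only [radial]
  push_cast
  ring

theorem smoothKF_radial_div_Δk {c : ℝ → ℝ} (hc : ContDiff ℝ (⊤ : ℕ∞) c) :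
    SmoothKF (KerrΩ M a) (radial fun r => c r / Δk M a r) :=
  smoothKF_radial fun _ hr => hc.contDiffAt.div (contDiff_Δk M a).contDiffAt hr

theorem smoothKF_radial_of_contDiff {c : ℝ → ℝ} (hc : ContDiff ℝ (⊤ : ℕ∞) c) :
    SmoothKF (KerrΩ M a) (radial c) :=
  smoothKF_radial fun _ _ => hc.contDiffAt

theorem e3_radial_mul {c : ℝ → ℝ} {c' t r θ φ : ℝ} (hc : SmoothKF (KerrΩ M a) (radial c))
    (h : HasDerivAt c c' r) (hf : SmoothKF (KerrΩ M a) f) (hp : (t, r, θ, φ) ∈ KerrΩ M a) :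
    e3 M a (radial c * f) t r θ φ =
      -(1 / 2) * (c' : ℂ) * f t r θ φ + (c r : ℂ) * e3 M a f t r θ φ := by
  rw [isDeriv_e3.mul hc hf t r θ φ hp]
  simp only [Pi.add_apply, Pi.mul_apply, e3_radial M a h, radial]

/-- The radial part of the Teukolsky operator preserves smoothness, and its commutator with `e₃`
is the full commutator. -/
theorem radialTeuk_e3_sub (hf : SmoothKF (KerrΩ M a) f) {t r θ φ : ℝ}
    (hp : (t, r, θ, φ) ∈ KerrΩ M a) :
    SmoothKF (KerrΩ M a) (radialTeuk M a s f) ∧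
    radialTeuk M a s (e3 M a f) t r θ φ - e3 M a (radialTeuk M a s f) t r θ φ =
      4 * ((r - M : ℝ) : ℂ) * e3 M a (e3 M a f) t r θ φ
        - 4 * (r : ℂ) * pt (e3 M a f) t r θ φ
        + 2 * ((s : ℂ) - 1) * e3 M a f t r θ φ
        + (1 - 2 * (s : ℂ)) * pt f t r θ φ := by
  have hU := isOpen_KerrΩ M a
  have hΔ0 := Δk_ne_zero_of_mem hp
  have h3 := isDeriv_e3 (M := M) (a := a)
  have sr := isDeriv_pr.smooth hf
  have st := isDeriv_pt.smooth hf
  have sp := isDeriv_pph.smooth hf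
  have srr := isDeriv_pr.smooth sr
  have stt := isDeriv_pt.smooth st
  have stp := isDeriv_pt.smooth sp
  have spp := isDeriv_pph.smooth sp
  have c₁ : SmoothKF (KerrΩ M a) (radial fun r => -(r ^ 2 + a ^ 2) ^ 2 / Δk M a r) :=
    smoothKF_radial_div_Δk (by fun_prop)
  have c₂ : SmoothKF (KerrΩ M a) (radial fun r => -4 * M * a * r / Δk M a r) :=
    smoothKF_radial_div_Δk (by fun_prop)
  have c₃ : SmoothKF (KerrΩ M a) (radial fun r => -a ^ 2 / Δk M a r) :=
    smoothKF_radial_div_Δk (by fun_prop)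
  have c₄ : SmoothKF (KerrΩ M a) (radial (Δk M a)) := smoothKF_radial_of_contDiff (contDiff_Δk M a)
  have c₅ : SmoothKF (KerrΩ M a) (radial fun r => 2 * (1 - s) * (r - M)) :=
    smoothKF_radial_of_contDiff (by fun_prop)
  have c₆ : SmoothKF (KerrΩ M a) (radial fun r => 2 * s * (a * (r - M)) / Δk M a r) :=
    smoothKF_radial_div_Δk (by fun_prop)
  have c₇ : SmoothKF (KerrΩ M a)
      (radial fun r => 2 * s * (M * (r ^ 2 - a ^ 2)) / Δk M a r - 2 * s * r) :=
    smoothKF_radial fun r hr => by unfold Δk at *; fun_prop (disch := exact hr)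
  have hid := hasDerivAt_id r
  have hsq : HasDerivAt (fun r : ℝ => r ^ 2) (2 * r) r := by simpa using hasDerivAt_pow 2 r
  have d₁ := hasDerivAt_div_Δk (M := M) (((hsq.add_const (a ^ 2)).pow 2).neg) hΔ0
  have d₂ := hasDerivAt_div_Δk (hid.const_mul (-4 * M * a)) hΔ0
  have d₃ := hasDerivAt_div_Δk (hasDerivAt_const r (-a ^ 2)) hΔ0
  have d₅ := (hid.sub_const M).const_mul (2 * (1 - s) : ℝ)
  have d₆ := hasDerivAt_div_Δk (((hid.sub_const M).const_mul a).const_mul (2 * s : ℝ)) hΔ0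
  have d₇ := (hasDerivAt_div_Δk (((hsq.sub_const (a ^ 2)).const_mul M).const_mul (2 * s : ℝ))
    hΔ0).sub (hid.const_mul (2 * s : ℝ))
  have m₁ := c₁.mul stt
  have m₂ := m₁.add (c₂.mul stp)
  have m₃ := m₂.add (c₃.mul spp)
  have m₄ := m₃.add (c₄.mul srr)
  have m₅ := m₄.add (c₅.mul sr)
  have m₆ := m₅.add (c₆.mul sp)
  refine ⟨m₆.add (c₇.mul st), ?_⟩
  have leibniz : e3 M a (radialTeuk M a s f) t r θ φ = _ :=
    (h3.add m₆ (c₇.mul st) t r θ φ hp).trans <| congrArg₂ (· + ·)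
      ((h3.add m₅ (c₆.mul sp) t r θ φ hp).trans <| congrArg₂ (· + ·)
      ((h3.add m₄ (c₅.mul sr) t r θ φ hp).trans <| congrArg₂ (· + ·)
      ((h3.add m₃ (c₄.mul srr) t r θ φ hp).trans <| congrArg₂ (· + ·)
      ((h3.add m₂ (c₃.mul spp) t r θ φ hp).trans <| congrArg₂ (· + ·)
      ((h3.add m₁ (c₂.mul stp) t r θ φ hp).trans <| congrArg₂ (· + ·)
        (e3_radial_mul c₁ d₁ stt hp) (e3_radial_mul c₂ d₂ stp hp))
        (e3_radial_mul c₃ d₃ spp hp)) (e3_radial_mul c₄ (hasDerivAt_Δk M a r) srr hp))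
        (e3_radial_mul c₅ d₅ sr hp)) (e3_radial_mul c₆ d₆ sp hp))
        (e3_radial_mul c₇ d₇ st hp)
  rw [leibniz]
  have ct := commutesWith_e3_pt (M := M) (a := a)
  have cp := commutesWith_e3_pph (M := M) (a := a)
  have et := ct.comm hf t r θ φ hp
  have ep := cp.comm hf t r θ φ hp
  have er := pr_e3 hf t r θ φ hp
  have err := pr_pr_e3 hf t r θ φ hp
  have ett := (ct.comp h3 ct).comm hf t r θ φ hp
  have etp := (ct.comp h3 cp).comm hf t r θ φ hp
  have epp := (cp.comp h3 cp).comm hf t r θ φ hp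
  have e33 : e3 M a (e3 M a f) t r θ φ = (1 / 2 : ℂ) * (-(pr (e3 M a f) t r θ φ)
    + (((r ^ 2 + a ^ 2) / Δk M a r : ℝ) : ℂ) * pt (e3 M a f) t r θ φ
    + ((a / Δk M a r : ℝ) : ℂ) * pph (e3 M a f) t r θ φ) := rfl
  have e3f : e3 M a f t r θ φ = (1 / 2 : ℂ) * (-(pr f t r θ φ)
    + (((r ^ 2 + a ^ 2) / Δk M a r : ℝ) : ℂ) * pt f t r θ φ
    + ((a / Δk M a r : ℝ) : ℂ) * pph f t r θ φ) := rfl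
  have e3r : e3 M a (pr f) t r θ φ = (1 / 2 : ℂ) * (-(pr (pr f) t r θ φ)
    + (((r ^ 2 + a ^ 2) / Δk M a r : ℝ) : ℂ) * pt (pr f) t r θ φ
    + ((a / Δk M a r : ℝ) : ℂ) * pph (pr f) t r θ φ) := rfl
  have e3t : e3 M a (pt f) t r θ φ = (1 / 2 : ℂ) * (-(pr (pt f) t r θ φ)
    + (((r ^ 2 + a ^ 2) / Δk M a r : ℝ) : ℂ) * pt (pt f) t r θ φ
    + ((a / Δk M a r : ℝ) : ℂ) * pph (pt f) t r θ φ) := rfl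
  have e3p : e3 M a (pph f) t r θ φ = (1 / 2 : ℂ) * (-(pr (pph f) t r θ φ)
    + (((r ^ 2 + a ^ 2) / Δk M a r : ℝ) : ℂ) * pt (pph f) t r θ φ
    + ((a / Δk M a r : ℝ) : ℂ) * pph (pph f) t r θ φ) := rfl
  simp only [radialTeuk, Pi.add_apply, Pi.mul_apply, radial, id] at er err ⊢
  rw [e33, err, er, ← et, ← ep, ← ett, ← etp, ← epp, e3f, e3r, e3t, e3p,
    (isDirDeriv_pr hU).comm hU (isDirDeriv_pt hU) hf t r θ φ hp,
    (isDirDeriv_pr hU).comm hU (isDirDeriv_pph hU) hf t r θ φ hp,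
    (isDirDeriv_pph hU).comm hU (isDirDeriv_pt hU) hf t r θ φ hp]
  have hd : (Δk M a r : ℂ) = (r : ℂ) ^ 2 - 2 * M * r + a ^ 2 := by
    unfold Δk; push_cast; rfl
  have hd0 : (Δk M a r : ℂ) ≠ 0 := Complex.ofReal_ne_zero.2 hΔ0
  simp only [Pi.neg_apply, Pi.pow_apply]
  push_cast
  generalize (Δk M a r : ℂ) = d at hd hd0 ⊢
  field_simp
  rw [hd]
  ring

end Kerr

/-- **Proposition (commutator `[𝐓_s, e₃]`).** -/
theorem stmt_5 (M a : ℝ) (ha : 0 < |a|) (haM : |a| < M) (s : ℤ) (ψ : KF)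
    (hψ : ContDiffOn ℝ (⊤ : ℕ∞) (fun p : ℝ × ℝ × ℝ × ℝ => ψ p.1 p.2.1 p.2.2.1 p.2.2.2) (KerrΩ M a)) :
    ∀ t r θ φ : ℝ,
      M - Real.sqrt (M^2 - a^2) < r → r < M + Real.sqrt (M^2 - a^2) →
      0 < θ → θ < Real.pi →
      Teuk M a s (e3 M a ψ) t r θ φ - e3 M a (Teuk M a s ψ) t r θ φ =
        4 * ((r - M : ℝ) : ℂ) * e3 M a (e3 M a ψ) t r θ φ
        - 4 * (r : ℂ) * pt (e3 M a ψ) t r θ φ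
        + 2 * ((s : ℂ) - 1) * e3 M a ψ t r θ φ
        + (1 - 2 * (s : ℂ)) * pt ψ t r θ φ := by
  intro t r θ φ h₁ h₂ h₃ h₄
  have hp : (t, r, θ, φ) ∈ KerrΩ M a := ⟨h₁, h₂, h₃, h₄⟩
  have hf : SmoothKF (KerrΩ M a) ψ := hψ
  obtain ⟨hR, hcomm⟩ := radialTeuk_e3_sub (s := s) hf hp
  have hQ := (commutesWith_e3_Qop (s := s)).smooth hf
  rw [Teuk_eq (isDeriv_e3.smooth hf) t r θ φ hp,
    ← isDeriv_e3.congr (hR.add hQ) (Teuk_eq hf).symm t r θ φ hp,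
    isDeriv_e3.add hR hQ t r θ φ hp, ← hcomm]
  simp only [Pi.add_apply]
  rw [commutesWith_e3_Qop.comm hf t r θ φ hp]
  ring
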